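/- Let h be a Hessenberg function on {1,…,n} and μ a composition of n. For every v ∈ S_n^μ and every w ∈ S_n: if w ∈ v S_μ v_μ then (v · f_μ)(w) = ∏_{(i,j)∈N_h^-(v_μ)} (t_{w(i)} − t_{w(j)}), and otherwise (v · f_μ)(w) = 0. In particular, the support {w ∈ S_n : (v · f_μ)(w) ≠ 0} equals the left coset v v_μ S_{μ'} of the Young subgroup S_{μ'}, and for distinct v_1, v_2 ∈ S_n^μ the supports of v_1 · f_μ and v_2 · f_μ are disjoint. -/

import Mathlib

open MvPolynomial Finset

/-- Partial sums of a composition: `psum μ i = μ 0 + ⋯ + μ (i-1)` (so `psum μ i = [μ]_i`). -/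
def psum (μ : ℕ → ℕ) (i : ℕ) : ℕ := ∑ t ∈ Finset.range i, μ t

/-- Membership in the Young subgroup `S_μ` (0-based): `y` maps each block
`{psum μ b, …, psum μ (b+1) - 1}` (for `b < L`) to itself. -/
def YoungC {n : ℕ} (μ : ℕ → ℕ) (L : ℕ) (y : Equiv.Perm (Fin n)) : Prop :=
  ∀ b, b < L → ∀ p : Fin n, psum μ b ≤ (p : ℕ) → (p : ℕ) < psum μ (b + 1) →
    psum μ b ≤ (y p : ℕ) ∧ (y p : ℕ) < psum μ (b + 1)

/-- `v` is the permutation `v_μ`, defined (1-based) by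
`v_μ([μ']_{ℓ-i-1} + j) = [μ]_i + j` for `0 ≤ i ≤ ℓ-1`, `1 ≤ j ≤ μ_{i+1}`,
written with 0-based indices. -/
def IsVmu {n : ℕ} (μ : ℕ → ℕ) (L : ℕ) (v : Equiv.Perm (Fin n)) : Prop :=
  ∀ i, i < L → ∀ j, j < μ i →
    ∀ (hp : psum (fun t => μ (L - 1 - t)) (L - 1 - i) + j < n) (hq : psum μ i + j < n),
      v ⟨psum (fun t => μ (L - 1 - t)) (L - 1 - i) + j, hp⟩ = ⟨psum μ i + j, hq⟩

/-- The set `N_h^-(v) = {(i,j) : j < i, v(i) < v(j), i ≤ h(j)}`. -/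
def NhSet {n : ℕ} (h : Fin n → Fin n) (v : Equiv.Perm (Fin n)) : Finset (Fin n × Fin n) :=
  Finset.univ.filter fun p => p.2 < p.1 ∧ v p.1 < v p.2 ∧ p.1 ≤ h p.2

/- The top-coset class `f_μ`:  `f_μ(w) = ∏_{(i,j) ∈ N_h^-(v_μ)} (t_{w(i)} - t_{w(j)})` if
`w ∈ S_μ v_μ`, and `f_μ(w) = 0` otherwise. -/
open Classical in
noncomputable def topClass {n : ℕ} (h : Fin n → Fin n) (μ : ℕ → ℕ) (L : ℕ)
    (vmu : Equiv.Perm (Fin n)) : Equiv.Perm (Fin n) → MvPolynomial (Fin n) ℂ :=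
  fun w =>
    if ∃ y, YoungC μ L y ∧ w = y * vmu then
      ∏ p ∈ NhSet h vmu, (X (w p.1) - X (w p.2))
    else 0

/-- The dot action `(v · f)(w) = v(f(v⁻¹ w))`. -/
noncomputable def dot {n : ℕ} (v : Equiv.Perm (Fin n))
    (f : Equiv.Perm (Fin n) → MvPolynomial (Fin n) ℂ) :
    Equiv.Perm (Fin n) → MvPolynomial (Fin n) ℂ :=
  fun w => rename (⇑v) (f (v⁻¹ * w))

/-- `v ∈ S_n^μ`, the shortest left coset representatives of `S_n / S_μ`:
`v(p) < v(p+1)` whenever `p+1` is not one of the partial sums `[μ]_b`, `b < L`. -/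
def ShortLeftC {n : ℕ} (μ : ℕ → ℕ) (L : ℕ) (v : Equiv.Perm (Fin n)) : Prop :=
  ∀ p q : Fin n, (p : ℕ) + 1 = (q : ℕ) → (∀ b, b < L → (q : ℕ) ≠ psum μ b) → v p < v q

/-- `v ∈ ^μS_n`, the shortest right coset representatives of `S_μ \ S_n`:
`v⁻¹(p) < v⁻¹(p+1)` whenever `p+1` is not one of the partial sums `[μ]_b`, `b < L`. -/
def ShortRightC {n : ℕ} (μ : ℕ → ℕ) (L : ℕ) (v : Equiv.Perm (Fin n)) : Prop :=
  ∀ p q : Fin n, (p : ℕ) + 1 = (q : ℕ) → (∀ b, b < L → (q : ℕ) ≠ psum μ b) → v⁻¹ p < v⁻¹ q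

theorem psum_succ (μ : ℕ → ℕ) (i : ℕ) : psum μ (i + 1) = psum μ i + μ i :=
  Finset.sum_range_succ _ _

theorem psum_mono (μ : ℕ → ℕ) : Monotone (psum μ) :=
  monotone_nat_of_le_succ fun i => by rw [psum_succ]; exact Nat.le_add_right _ _

theorem psum_reverse (μ : ℕ → ℕ) (L : ℕ) : psum (fun t => μ (L - 1 - t)) L = psum μ L :=
  Finset.sum_range_reflect μ L

/-- The position `p` lies in the `b`-th block of the composition `μ`. -/
def InBlock (μ : ℕ → ℕ) (b p : ℕ) : Prop := psum μ b ≤ p ∧ p < psum μ (b + 1)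

theorem InBlock.lt_of_index_lt {μ : ℕ → ℕ} {b c p q : ℕ} (hp : InBlock μ b p)
    (hq : InBlock μ c q) (hbc : b < c) : p < q :=
  hp.2.trans_le ((psum_mono μ hbc).trans hq.1)

theorem InBlock.index_le {μ : ℕ → ℕ} {b c p q : ℕ} (hp : InBlock μ b p)
    (hq : InBlock μ c q) (hpq : p ≤ q) : b ≤ c :=
  not_lt.1 fun hcb => (hq.lt_of_index_lt hp hcb).not_ge hpq

theorem exists_inBlock (μ : ℕ → ℕ) {L p : ℕ} (hp : p < psum μ L) :
    ∃ b < L, InBlock μ b p := by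
  induction L with
  | zero => simp [_root_.psum] at hp
  | succ L ih =>
    by_cases hL : p < psum μ L
    · obtain ⟨b, hb, hbp⟩ := ih hL
      exact ⟨b, hb.trans L.lt_succ_self, hbp⟩
    · exact ⟨L, L.lt_succ_self, not_lt.1 hL, hp⟩

section Young

variable {n : ℕ} {μ : ℕ → ℕ} {L : ℕ}

theorem YoungC.inBlock {y : Equiv.Perm (Fin n)} (hy : YoungC μ L y) {b : ℕ} (hb : b < L)
    {p : Fin n} (hp : InBlock μ b p) : InBlock μ b (y p) :=
  hy b hb p hp.1 hp.2

theorem YoungC.mul {y z : Equiv.Perm (Fin n)} (hy : YoungC μ L y) (hz : YoungC μ L z) :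
    YoungC μ L (y * z) :=
  fun _ hb _ h₁ h₂ => hy.inBlock hb (hz.inBlock hb ⟨h₁, h₂⟩)

theorem YoungC.inv (htot : psum μ L = n) {y : Equiv.Perm (Fin n)} (hy : YoungC μ L y) :
    YoungC μ L y⁻¹ := by
  intro b _ p h₁ h₂
  obtain ⟨c, hc, hcp⟩ := exists_inBlock μ ((y⁻¹ p).isLt.trans_eq htot.symm)
  have hp : InBlock μ c p := by simpa using hy.inBlock hc hcp
  have hb' : InBlock μ b p := ⟨h₁, h₂⟩
  obtain rfl : c = b := le_antisymm (hp.index_le hb' le_rfl) (hb'.index_le hp le_rfl)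
  exact hcp

theorem ShortLeftC.lt_of_inBlock {v : Equiv.Perm (Fin n)} (hv : ShortLeftC μ L v) {b : ℕ}
    {p q : Fin n} (hp : InBlock μ b p) (hq : InBlock μ b q) (hpq : p < q) : v p < v q := by
  obtain ⟨q, hqn⟩ := q
  have hpq' : (p : ℕ) + 1 ≤ q := hpq
  have step : ∀ r (hr : r + 1 < n), (p : ℕ) ≤ r → r + 1 ≤ q →
      v ⟨r, r.lt_succ_self.trans hr⟩ < v ⟨r + 1, hr⟩ := by
    intro r hr hpr hrq
    refine hv _ _ rfl fun c _ hc => ?_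
    have h₁ := hp.1
    have h₂ : q < psum μ (b + 1) := hq.2
    replace hc : r + 1 = psum μ c := hc
    rcases Nat.lt_or_ge b c with hbc | hcb
    · have := psum_mono μ (Nat.succ_le_of_lt hbc)
      simp only [Nat.succ_eq_add_one] at this
      omega
    · have := psum_mono μ hcb
      omega
  clear hpq
  induction q, hpq' using Nat.le_induction with
  | base => exact step p hqn le_rfl le_rfl
  | succ r hr ih =>
    have hpr : (p : ℕ) ≤ r := (Nat.le_succ _).trans hr
    refine (ih (r.lt_succ_self.trans hqn) ⟨hp.1.trans hpr, r.lt_succ_self.trans hq.2⟩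
      fun s hs h₁ h₂ => step s hs h₁ (h₂.trans r.le_succ)).trans (step r hqn hpr le_rfl)

/-- A left coset of the Young subgroup contains at most one shortest representative. -/
theorem ShortLeftC.eq_of_mul_eq (htot : psum μ L = n) {v₁ v₂ y : Equiv.Perm (Fin n)}
    (hv₁ : ShortLeftC μ L v₁) (hv₂ : ShortLeftC μ L v₂) (hy : YoungC μ L y)
    (h : v₂ = v₁ * y) : v₁ = v₂ := by
  have hmono : StrictMono y := by
    intro p q hpq
    obtain ⟨b, hb, hbp⟩ := exists_inBlock μ (p.isLt.trans_eq htot.symm)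
    obtain ⟨c, hc, hcq⟩ := exists_inBlock μ (q.isLt.trans_eq htot.symm)
    rcases (hbp.index_le hcq hpq.le).lt_or_eq with hbc | rfl
    · exact (hy.inBlock hb hbp).lt_of_index_lt (hy.inBlock hc hcq) hbc
    · have hlt : v₁ (y p) < v₁ (y q) := by
        simpa [h] using hv₂.lt_of_inBlock hbp hcq hpq
      by_contra hle
      rcases (not_lt.1 hle).lt_or_eq with hlt' | heq
      · exact hlt.asymm (hv₁.lt_of_inBlock (hy.inBlock hb hcq) (hy.inBlock hb hbp) hlt')
      · exact hlt.ne (by rw [heq])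
  have hid : (y : Fin n → Fin n) = id :=
    (hmono.range_inj strictMono_id).1 (by simp [y.surjective.range_eq])
  obtain rfl : y = 1 := Equiv.ext fun p => congrFun hid p
  simp [h]

/-- `v_μ` maps the blocks of the reversed composition onto the blocks of `μ`, in reverse order. -/
theorem IsVmu.inBlock_iff (htot : psum μ L = n) {vmu : Equiv.Perm (Fin n)}
    (hvmu : IsVmu μ L vmu) {b : ℕ} (hb : b < L) (p : Fin n) :
    InBlock μ b (vmu p) ↔ InBlock (fun t => μ (L - 1 - t)) (L - 1 - b) p := by
  have hidx : L - 1 - (L - 1 - b) = b := by omega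
  have hsize := psum_succ (fun t => μ (L - 1 - t)) (L - 1 - b)
  simp only [hidx] at hsize
  have hsize' := psum_succ μ b
  have hbound := psum_mono μ (Nat.succ_le_of_lt hb)
  have hbound' := psum_mono (fun t => μ (L - 1 - t)) (show L - 1 - b + 1 ≤ L by omega)
  rw [psum_reverse] at hbound'
  simp only [Nat.succ_eq_add_one] at hbound
  constructor
  · rintro ⟨h₁, h₂⟩
    obtain ⟨j, hj⟩ := Nat.exists_eq_add_of_le h₁
    have hjb : j < μ b := by omega
    have hval := hvmu b hb j hjb (by omega) (by omega)
    have hp := vmu.injective (hval.trans (Fin.ext hj.symm))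
    rw [← hp]
    constructor
    · exact Nat.le_add_right _ _
    · rw [hsize]; exact Nat.add_lt_add_left hjb _
  · rintro ⟨h₁, h₂⟩
    obtain ⟨j, hj⟩ := Nat.exists_eq_add_of_le h₁
    have hjb : j < μ b := by omega
    have hval := hvmu b hb j hjb (by omega) (by omega)
    have hp : p = ⟨psum (fun t => μ (L - 1 - t)) (L - 1 - b) + j, by omega⟩ := Fin.ext hj
    rw [hp, hval]
    constructor
    · exact Nat.le_add_right _ _
    · rw [hsize']; exact Nat.add_lt_add_left hjb _

/-- Conjugation by `v_μ` carries `S_{μ'}` to `S_μ`. -/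
theorem IsVmu.youngC_iff (htot : psum μ L = n) {vmu : Equiv.Perm (Fin n)}
    (hvmu : IsVmu μ L vmu) {y z : Equiv.Perm (Fin n)} (hyz : y * vmu = vmu * z) :
    YoungC μ L y ↔ YoungC (fun t => μ (L - 1 - t)) L z := by
  have hval : ∀ p, y (vmu p) = vmu (z p) := fun p => DFunLike.congr_fun hyz p
  constructor
  · intro hy c hc p h₁ h₂
    have hb : L - 1 - c < L := by omega
    have key := hvmu.inBlock_iff htot hb
    rw [show L - 1 - (L - 1 - c) = c by omega] at key
    have := hy.inBlock hb ((key p).2 ⟨h₁, h₂⟩)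
    rw [hval] at this
    exact (key (z p)).1 this
  · intro hz b hb p h₁ h₂
    have key := hvmu.inBlock_iff htot hb
    obtain ⟨q, rfl⟩ := vmu.surjective p
    rw [hval]
    exact (key (z q)).2 (hz.inBlock (by omega) ((key q).1 ⟨h₁, h₂⟩))

end Young

theorem prod_X_sub_X_ne_zero {n : ℕ} (h : Fin n → Fin n) (vmu w : Equiv.Perm (Fin n)) :
    ∏ p ∈ NhSet h vmu, (X (w p.1) - X (w p.2) : MvPolynomial (Fin n) ℂ) ≠ 0 := by
  refine Finset.prod_ne_zero_iff.2 fun p hp => sub_ne_zero.2 fun heq => ?_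
  have hlt : p.2 < p.1 := (Finset.mem_filter.1 hp).2.1
  exact hlt.ne' (w.injective (X_injective heq))

section DotTopClass

variable {n : ℕ} (h : Fin n → Fin n) {μ : ℕ → ℕ} {L : ℕ} {v vmu w : Equiv.Perm (Fin n)}

theorem dot_topClass_of_mem (hw : ∃ y, YoungC μ L y ∧ w = v * y * vmu) :
    dot v (topClass h μ L vmu) w = ∏ p ∈ NhSet h vmu, (X (w p.1) - X (w p.2)) := by
  obtain ⟨y, hy, hwy⟩ := hw
  have hmem : ∃ y, YoungC μ L y ∧ v⁻¹ * w = y * vmu := ⟨y, hy, by rw [hwy]; group⟩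
  rw [dot, topClass, if_pos hmem, map_prod]
  simp

theorem dot_topClass_of_notMem (hw : ¬ ∃ y, YoungC μ L y ∧ w = v * y * vmu) :
    dot v (topClass h μ L vmu) w = 0 := by
  have hmem : ¬ ∃ y, YoungC μ L y ∧ v⁻¹ * w = y * vmu := fun ⟨y, hy, hwy⟩ =>
    hw ⟨y, hy, by rw [mul_assoc, ← hwy]; group⟩
  rw [dot, topClass, if_neg hmem, map_zero]

theorem dot_topClass_ne_zero_iff :
    dot v (topClass h μ L vmu) w ≠ 0 ↔ ∃ y, YoungC μ L y ∧ w = v * y * vmu := by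
  refine ⟨fun hne => by_contra fun hw => hne (dot_topClass_of_notMem h hw), fun hw => ?_⟩
  rw [dot_topClass_of_mem h hw]
  exact prod_X_sub_X_ne_zero h vmu w

end DotTopClass

/-- Lemma 3.4 / `lem.left-coset-description`: values and support of
`v · f_μ` for `v ∈ S_n^μ`; the support is the left coset `v v_μ S_{μ'}` and the supports of
`v₁ · f_μ`, `v₂ · f_μ` for distinct `v₁, v₂ ∈ S_n^μ` are disjoint. -/
theorem statement7 (n : ℕ) (h : Fin n → Fin n) (hmono : Monotone h) (hgrow : ∀ i, i ≤ h i)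
    (μ : ℕ → ℕ) (L : ℕ) (hpos : ∀ i, i < L → 0 < μ i) (htot : psum μ L = n)
    (vmu : Equiv.Perm (Fin n)) (hvmu : IsVmu μ L vmu) :
    (∀ v : Equiv.Perm (Fin n), ShortLeftC μ L v →
      (∀ w : Equiv.Perm (Fin n), (∃ y : Equiv.Perm (Fin n), YoungC μ L y ∧ w = v * y * vmu) →
        dot v (topClass h μ L vmu) w = ∏ p ∈ NhSet h vmu, (X (w p.1) - X (w p.2))) ∧
      (∀ w : Equiv.Perm (Fin n),
        (¬ ∃ y : Equiv.Perm (Fin n), YoungC μ L y ∧ w = v * y * vmu) →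
        dot v (topClass h μ L vmu) w = 0) ∧
      ({w : Equiv.Perm (Fin n) | dot v (topClass h μ L vmu) w ≠ 0} =
        {w : Equiv.Perm (Fin n) | ∃ z : Equiv.Perm (Fin n),
          YoungC (fun t => μ (L - 1 - t)) L z ∧ w = v * vmu * z})) ∧
    (∀ v₁ v₂ : Equiv.Perm (Fin n), ShortLeftC μ L v₁ → ShortLeftC μ L v₂ → v₁ ≠ v₂ →
      {w : Equiv.Perm (Fin n) | dot v₁ (topClass h μ L vmu) w ≠ 0} ∩
        {w : Equiv.Perm (Fin n) | dot v₂ (topClass h μ L vmu) w ≠ 0} = ∅) := by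
  refine ⟨fun v _ => ⟨fun w => dot_topClass_of_mem h, fun w => dot_topClass_of_notMem h, ?_⟩, ?_⟩
  · ext w
    rw [Set.mem_ofPred_eq, dot_topClass_ne_zero_iff]
    constructor
    · rintro ⟨y, hy, rfl⟩
      exact ⟨vmu⁻¹ * y * vmu, (hvmu.youngC_iff htot (by group)).1 hy, by group⟩
    · rintro ⟨z, hz, rfl⟩
      exact ⟨vmu * z * vmu⁻¹, (hvmu.youngC_iff htot (by group)).2 hz, by group⟩
  · intro v₁ v₂ hv₁ hv₂ hne
    refine Set.eq_empty_iff_forall_notMem.2 fun w ⟨hw₁, hw₂⟩ => hne ?_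
    obtain ⟨y₁, hy₁, rfl⟩ := (dot_topClass_ne_zero_iff h).1 hw₁
    obtain ⟨y₂, hy₂, heq⟩ := (dot_topClass_ne_zero_iff h).1 hw₂
    refine hv₁.eq_of_mul_eq htot hv₂ (hy₁.mul (hy₂.inv htot)) ?_
    rw [← mul_assoc, mul_right_cancel heq, mul_inv_cancel_right]
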